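/- Let n = 2ν be even and J₀ the canonical antisymmetric matrix of order n. For a symmetric matrix Z ∈ 𝕊ₙ and a Frechet differentiable function v : ℝ^{n×n} × 𝕊ₙ → ℝ, define L_Z(v)(X,Y) := ⟨Z, 𝐒(M(v) J₀)⟩, where M(v) := (1/2) Xᵀ ∂_X v + Y ∂_Y v and 𝐒(N) := (N+Nᵀ)/2. Then for any constant symmetric matrices Z₁, Z₂ ∈ 𝕊ₙ and any twice continuously Frechet differentiable v, the involutivity condition holds: L_{Z₁}(L_{Z₂}(v)) - L_{Z₂}(L_{Z₁}(v)) = L_{Z₃}(v), where Z₃ := (Z₂ J₀ Z₁ - Z₁ J₀ Z₂)/2 is symmetric. -/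

import Mathlib

open Matrix
open scoped Kronecker

attribute [local instance] Matrix.frobeniusNormedAddCommGroup Matrix.frobeniusNormedSpace

/-- Index type for matrices of even order `n = 2ν`. -/
abbrev Idx (ν : ℕ) := Fin ν × Fin 2

/-- The canonical antisymmetric matrix `J₀ = I_ν ⊗ [[0,1],[-1,0]]` of order `n = 2ν`. -/
noncomputable def J0 (ν : ℕ) : Matrix (Idx ν) (Idx ν) ℝ :=
  (1 : Matrix (Fin ν) (Fin ν) ℝ) ⊗ₖ !![(0 : ℝ), 1; -1, 0]

/-- The subspace `𝕊ₙ` of real symmetric matrices. -/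
def symMat (ν : ℕ) : Submodule ℝ (Matrix (Idx ν) (Idx ν) ℝ) where
  carrier := {Y | Yᵀ = Y}
  add_mem' := by
    intro a b ha hb
    simp only [Set.mem_setOf_eq] at *
    rw [Matrix.transpose_add, ha, hb]
  zero_mem' := by simp
  smul_mem' := by
    intro c a ha
    simp only [Set.mem_setOf_eq] at *
    rw [Matrix.transpose_smul, ha]

/-- The Frobenius inner product `⟨A, B⟩ = tr(Aᵀ B)`. -/
noncomputable def frob {ν : ℕ} (A B : Matrix (Idx ν) (Idx ν) ℝ) : ℝ :=
  (Aᵀ * B).trace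

/-- The symmetrizer `𝐒(N) = (N + Nᵀ)/2`. -/
noncomputable def symm' {ν : ℕ} (N : Matrix (Idx ν) (Idx ν) ℝ) :
    Matrix (Idx ν) (Idx ν) ℝ :=
  (1 / 2 : ℝ) • (N + Nᵀ)

/-- The commutator of the derivations along two continuous linear vector fields is the derivation
along the (reversed) commutator of the fields, for functions of class `C²`. -/
lemma fderiv_linear_field_commutator {E : Type*} [NormedAddCommGroup E] [NormedSpace ℝ E]
    {v : E → ℝ} (hv : ContDiff ℝ 2 v) (A B : E →L[ℝ] E) (p : E) {LA LB : E →L[ℝ] ℝ}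
    (hA : HasFDerivAt (fun q => fderiv ℝ v q (A q)) LA p)
    (hB : HasFDerivAt (fun q => fderiv ℝ v q (B q)) LB p) :
    LB (A p) - LA (B p) = fderiv ℝ v p (B (A p) - A (B p)) := by
  have hd : DifferentiableAt ℝ (fderiv ℝ v) p :=
    ((hv.fderiv_right (m := 1) (by norm_num)).differentiable (by norm_num)) p
  have hsymm : IsSymmSndFDerivAt ℝ v p :=
    hv.contDiffAt.isSymmSndFDerivAt (by simp)
  have eA := hA.unique (hd.hasFDerivAt.clm_apply A.hasFDerivAt)
  have eB := hB.unique (hd.hasFDerivAt.clm_apply B.hasFDerivAt)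
  subst eA eB
  simp [hsymm.eq (A p) (B p)]

lemma J0_transpose (ν : ℕ) : (J0 ν)ᵀ = -J0 ν := by
  ext ⟨i, a⟩ ⟨j, b⟩
  fin_cases a <;> fin_cases b <;> simp [J0, Matrix.kroneckerMap_apply, Matrix.one_apply, eq_comm]

/-- The linear vector field `(X, Y) ↦ (X Bᵀ / 2, (B Y + Y Bᵀ) / 2)`. -/
noncomputable def congrField {ν : ℕ} (B : Matrix (Idx ν) (Idx ν) ℝ) :
    (Matrix (Idx ν) (Idx ν) ℝ × symMat ν) →ₗ[ℝ] (Matrix (Idx ν) (Idx ν) ℝ × symMat ν) where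
  toFun q := ((1 / 2 : ℝ) • (q.1 * Bᵀ),
    ⟨(1 / 2 : ℝ) • (B * (q.2 : Matrix (Idx ν) (Idx ν) ℝ) + q.2 * Bᵀ), by
      have h : (q.2 : Matrix (Idx ν) (Idx ν) ℝ)ᵀ = q.2 := q.2.2
      change _ᵀ = _
      rw [transpose_smul, transpose_add, transpose_mul, transpose_mul, transpose_transpose, h,
        add_comm]⟩)
  map_add' q r := by
    ext1
    · simp [add_mul]
    · ext1
      simp only [Prod.snd_add, Submodule.coe_add, mul_add, add_mul, ← smul_add]
      congr 1
      abel
  map_smul' c q := by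
    ext1
    · simp [smul_comm c]
    · ext1
      simp [smul_comm c]

lemma congrField_commutator {ν : ℕ} (B C : Matrix (Idx ν) (Idx ν) ℝ)
    (q : Matrix (Idx ν) (Idx ν) ℝ × symMat ν) :
    congrField B (congrField C q) - congrField C (congrField B q) =
      congrField ((1 / 2 : ℝ) • (B * C - C * B)) q := by
  ext1
  · simp only [congrField, LinearMap.coe_mk, AddHom.coe_mk, Prod.fst_sub, transpose_smul,
      transpose_sub, transpose_mul, Matrix.mul_smul, Matrix.smul_mul, Matrix.mul_sub,
      Matrix.mul_assoc, smul_sub]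
  · ext1
    simp only [congrField, LinearMap.coe_mk, AddHom.coe_mk, Prod.snd_sub, transpose_smul,
      transpose_sub, transpose_mul, Matrix.mul_smul, Matrix.smul_mul, Matrix.mul_sub,
      Matrix.sub_mul, Matrix.mul_add, Matrix.add_mul, Matrix.mul_assoc, Submodule.coe_sub]
    module

/-- The operator `L_Z` is the derivation along the linear field `congrField (J₀ Z)`. -/
lemma frob_symm'_eq_congrField {ν : ℕ} {Z : Matrix (Idx ν) (Idx ν) ℝ} (hZ : Zᵀ = Z)
    (G : Matrix (Idx ν) (Idx ν) ℝ) (H : symMat ν) (q : Matrix (Idx ν) (Idx ν) ℝ × symMat ν) :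
    frob Z (symm' (((1 / 2 : ℝ) • (q.1ᵀ * G) +
        (q.2 : Matrix (Idx ν) (Idx ν) ℝ) * (H : Matrix (Idx ν) (Idx ν) ℝ)) * J0 ν)) =
      frob G (congrField (J0 ν * Z) q).1 +
        frob (H : Matrix (Idx ν) (Idx ν) ℝ)
          ((congrField (J0 ν * Z) q).2 : Matrix (Idx ν) (Idx ν) ℝ) := by
  obtain ⟨X, Y, hY⟩ := q
  obtain ⟨H, hH⟩ := H
  change Yᵀ = Y at hY
  change Hᵀ = H at hH
  have hsym (N : Matrix (Idx ν) (Idx ν) ℝ) : frob Z (symm' N) = (Z * N).trace := by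
    have h : (Z * Nᵀ).trace = (Z * N).trace := by
      rw [← trace_transpose, transpose_mul, transpose_transpose, hZ, trace_mul_comm]
    simp only [frob, symm', hZ, Matrix.mul_smul, Matrix.mul_add, trace_smul, trace_add, h,
      smul_eq_mul]
    ring
  have hX : (Gᵀ * (X * (J0 ν * Z)ᵀ)).trace = (Z * (Xᵀ * G * J0 ν)).trace := by
    rw [← trace_transpose, transpose_mul, transpose_mul, transpose_transpose, transpose_transpose,
      Matrix.mul_assoc, Matrix.mul_assoc, trace_mul_comm]
    simp only [Matrix.mul_assoc]
  have hB : (H * (J0 ν * Z * Y)).trace = (Z * (Y * H * J0 ν)).trace := by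
    rw [trace_mul_comm, Matrix.mul_assoc, Matrix.mul_assoc, trace_mul_comm]
    simp only [Matrix.mul_assoc]
  have hBt : (H * (Y * (J0 ν * Z)ᵀ)).trace = (Z * (Y * H * J0 ν)).trace := by
    rw [← trace_transpose, transpose_mul, transpose_mul, transpose_transpose, hH, hY,
      trace_mul_comm, hB]
  rw [hsym]
  simp only [frob, congrField, LinearMap.coe_mk, AddHom.coe_mk, hH, Matrix.mul_smul,
    Matrix.smul_mul, Matrix.mul_add, Matrix.add_mul, trace_smul, trace_add, hX, hB, hBt,
    smul_eq_mul]
  ring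

theorem stmt_7 (ν : ℕ)
    (v : Matrix (Idx ν) (Idx ν) ℝ × symMat ν → ℝ)
    -- v is twice continuously Frechet differentiable
    (hv : ContDiff ℝ 2 v)
    -- Frobenius gradient data (∂_X v, ∂_Y v) for v
    (gX : Matrix (Idx ν) (Idx ν) ℝ × symMat ν → Matrix (Idx ν) (Idx ν) ℝ)
    (gY : Matrix (Idx ν) (Idx ν) ℝ × symMat ν → symMat ν)
    (Lv : Matrix (Idx ν) (Idx ν) ℝ × symMat ν →
          (Matrix (Idx ν) (Idx ν) ℝ × symMat ν) →L[ℝ] ℝ)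
    (hLv : ∀ p, HasFDerivAt v (Lv p) p)
    (hrep : ∀ p δ, Lv p δ = frob (gX p) δ.1 +
      frob (gY p : Matrix (Idx ν) (Idx ν) ℝ) (δ.2 : Matrix (Idx ν) (Idx ν) ℝ))
    -- constant symmetric matrices Z₁, Z₂
    (Z₁ Z₂ : Matrix (Idx ν) (Idx ν) ℝ) (hZ₁ : Z₁ᵀ = Z₁) (hZ₂ : Z₂ᵀ = Z₂)
    (p : Matrix (Idx ν) (Idx ν) ℝ × symMat ν)
    -- Frobenius gradient data for L_{Z₂}(v) at p
    (hX₂ : Matrix (Idx ν) (Idx ν) ℝ) (hY₂ : symMat ν)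
    (L₂ : (Matrix (Idx ν) (Idx ν) ℝ × symMat ν) →L[ℝ] ℝ)
    (hL₂ : HasFDerivAt
      (fun q : Matrix (Idx ν) (Idx ν) ℝ × symMat ν =>
        frob Z₂ (symm' (((1 / 2 : ℝ) • (q.1ᵀ * gX q) +
          (q.2 : Matrix (Idx ν) (Idx ν) ℝ) * (gY q : Matrix (Idx ν) (Idx ν) ℝ)) * J0 ν)))
      L₂ p)
    (hrep₂ : ∀ δ, L₂ δ = frob hX₂ δ.1 +
      frob (hY₂ : Matrix (Idx ν) (Idx ν) ℝ) (δ.2 : Matrix (Idx ν) (Idx ν) ℝ))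
    -- Frobenius gradient data for L_{Z₁}(v) at p
    (hX₁ : Matrix (Idx ν) (Idx ν) ℝ) (hY₁ : symMat ν)
    (L₁ : (Matrix (Idx ν) (Idx ν) ℝ × symMat ν) →L[ℝ] ℝ)
    (hL₁ : HasFDerivAt
      (fun q : Matrix (Idx ν) (Idx ν) ℝ × symMat ν =>
        frob Z₁ (symm' (((1 / 2 : ℝ) • (q.1ᵀ * gX q) +
          (q.2 : Matrix (Idx ν) (Idx ν) ℝ) * (gY q : Matrix (Idx ν) (Idx ν) ℝ)) * J0 ν)))
      L₁ p)
    (hrep₁ : ∀ δ, L₁ δ = frob hX₁ δ.1 +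
      frob (hY₁ : Matrix (Idx ν) (Idx ν) ℝ) (δ.2 : Matrix (Idx ν) (Idx ν) ℝ)) :
    -- the involutivity condition L_{Z₁}(L_{Z₂}(v)) - L_{Z₂}(L_{Z₁}(v)) = L_{Z₃}(v) at p,
    -- with Z₃ := (Z₂ J₀ Z₁ - Z₁ J₀ Z₂)/2
    frob Z₁ (symm' (((1 / 2 : ℝ) • (p.1ᵀ * hX₂) +
        (p.2 : Matrix (Idx ν) (Idx ν) ℝ) * (hY₂ : Matrix (Idx ν) (Idx ν) ℝ)) * J0 ν)) -
      frob Z₂ (symm' (((1 / 2 : ℝ) • (p.1ᵀ * hX₁) +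
        (p.2 : Matrix (Idx ν) (Idx ν) ℝ) * (hY₁ : Matrix (Idx ν) (Idx ν) ℝ)) * J0 ν)) =
    frob ((1 / 2 : ℝ) • (Z₂ * J0 ν * Z₁ - Z₁ * J0 ν * Z₂))
      (symm' (((1 / 2 : ℝ) • (p.1ᵀ * gX p) +
        (p.2 : Matrix (Idx ν) (Idx ν) ℝ) * (gY p : Matrix (Idx ν) (Idx ν) ℝ)) * J0 ν)) := by
  have hfd (q) : Lv q = fderiv ℝ v q := (hLv q).fderiv.symm
  have hZ₃ : ((1 / 2 : ℝ) • (Z₂ * J0 ν * Z₁ - Z₁ * J0 ν * Z₂))ᵀ =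
      (1 / 2 : ℝ) • (Z₂ * J0 ν * Z₁ - Z₁ * J0 ν * Z₂) := by
    simp only [transpose_smul, transpose_sub, transpose_mul, J0_transpose, hZ₁, hZ₂,
      Matrix.neg_mul, Matrix.mul_neg, Matrix.mul_assoc]
    congr 1
    abel
  simp only [frob_symm'_eq_congrField hZ₁, frob_symm'_eq_congrField hZ₂,
    frob_symm'_eq_congrField hZ₃, ← hrep, ← hrep₁, ← hrep₂, hfd] at hL₁ hL₂ ⊢
  have h := fderiv_linear_field_commutator hv (congrField (J0 ν * Z₁)).toContinuousLinearMap
    (congrField (J0 ν * Z₂)).toContinuousLinearMap p hL₁ hL₂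
  refine h.trans ?_
  refine congrArg (fderiv ℝ v p) ((congrField_commutator _ _ p).trans ?_)
  simp only [Matrix.mul_smul, Matrix.mul_sub, Matrix.mul_assoc]
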